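/- arXiv:1906.12054 — 4 statements merged into one kernel-verified Lean document; each statement's English description precedes it below -/
import Mathlib

section
/- Let F_q be a finite field of odd order q, let λ ∈ F_q be a non-square element, and let a ∈ F_q with a ≠ 1/4. Then in the equational graph G(λ, X² + X + a), there are at least ⌊(1/4)(q − 3√q) − 1⌋ vertices having zero in-degree. -/
open Polynomial

/-- Edge relation of the equational graph `G(l, f)` over a field:
there is an edge from `x` to `y` iff `(y² - f(x))·(l·y² - f(x)) = 0`. -/
def EqEdge {F : Type*} [Field F] (l : F) (f : Polynomial F) (x y : F) : Prop :=
  (y ^ 2 - f.eval x) * (l * y ^ 2 - f.eval x) = 0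

/-- Weak reachability: reachability in the underlying undirected graph. -/
def WeakReach {V : Type*} (E : V → V → Prop) : V → V → Prop :=
  Relation.ReflTransGen fun u v => E u v ∨ E v u

/-- The weakly connected component of a vertex. -/
def WeakComp {V : Type*} (E : V → V → Prop) (x : V) : Set V :=
  {y | WeakReach E x y}

/-- A directed cycle of length `n ≥ 1`, visiting `n` distinct vertices. -/
def IsCycle {V : Type*} (E : V → V → Prop) (n : ℕ) (v : ZMod n → V) : Prop :=
  0 < n ∧ Function.Injective v ∧ ∀ i, E (v i) (v (i + 1))

/-- A directed path with `m` edges and `m + 1` distinct vertices `v 0, v 1, ..., v m`. -/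
def IsPathOn {V : Type*} (E : V → V → Prop) (m : ℕ) (v : ℕ → V) : Prop :=
  (∀ i < m, E (v i) (v (i + 1))) ∧ ∀ i ≤ m, ∀ j ≤ m, v i = v j → i = j

open Classical in
/-- The weight of the edge `(x, y)` in `G(l, f)`: `0` if `y² = f(x)`, and `1` otherwise. -/
noncomputable def wt {F : Type*} [Field F] (l : F) (f : Polynomial F) (x y : F) : ℕ :=
  if y ^ 2 = f.eval x then 0 else 1

/-- A sequence `w` of `m` edge weights contains a trail of length `n`
(`n` consecutive edges of the same weight). -/
def ContainsTrail (w : ℕ → ℕ) (m n : ℕ) : Prop :=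
  ∃ i, i + n ≤ m ∧ ∀ k < n, w (i + k) = w i

/-- A path with `m` edges whose weights are given by `w` is of Type `n`:
it contains a trail of length `n` but none of greater length. -/
def PathTypeN (w : ℕ → ℕ) (m n : ℕ) : Prop :=
  ContainsTrail w m n ∧ ∀ k, n < k → ¬ ContainsTrail w m k

/-- `c` is a Hamiltonian cycle of the (connected) equational graph `G(l, f)` which is of
Type `n`, i.e. removing the vertex `0` from the cycle leaves a path of Type `n`. -/
def IsHamCycleOfType {F : Type*} [Field F] [Fintype F] (l : F) (f : Polynomial F)
    (c : ZMod (Fintype.card F) → F) (n : ℕ) : Prop :=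
  Function.Bijective c ∧ (∀ i, EqEdge l f (c i) (c (i + 1))) ∧
  ∃ i0 : ZMod (Fintype.card F), c i0 = 0 ∧
    PathTypeN (fun k => wt l f (c (i0 + 1 + (k : ZMod (Fintype.card F))))
      (c (i0 + 1 + (k : ZMod (Fintype.card F)) + 1))) (Fintype.card F - 2) n

open Classical in
/-- The quadratic character of a field: `1` on non-zero squares, `-1` on non-squares,
and `qchar 0 = 0`. -/
noncomputable def qchar {F : Type*} [Field F] (u : F) : ℤ :=
  if u = 0 then 0 else if ∃ z : F, z ^ 2 = u then 1 else -1

/-- The `K`-linear map sending a family `c i j` to the polynomial `∑ c i j * X ^ (a * i + b * j)`. -/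
noncomputable def gridPoly (K : Type*) [Field K] (a b m M : ℕ) :
    (Fin m × Fin M → K) →ₗ[K] K[X] :=
  Fintype.linearCombination K fun p => X ^ (a * (p.1 : ℕ) + b * (p.2 : ℕ))

lemma gridPoly_apply {K : Type*} [Field K] (a b m M : ℕ) (c : Fin m × Fin M → K) :
    gridPoly K a b m M c = ∑ p, monomial (a * (p.1 : ℕ) + b * (p.2 : ℕ)) (c p) := by
  simp [gridPoly, Fintype.linearCombination_apply, smul_X_eq_monomial]

lemma eval_gridPoly {K : Type*} [Field K] (a b m M : ℕ) (c : Fin m × Fin M → K) (z : K) :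
    (gridPoly K a b m M c).eval z = ∑ p, c p * z ^ (a * (p.1 : ℕ) + b * (p.2 : ℕ)) := by
  simp [gridPoly_apply, eval_finsetSum]

lemma natDegree_gridPoly_le {K : Type*} [Field K] {a b m M d : ℕ} (c : Fin m × Fin M → K)
    (hd : a * (m - 1) + b * (M - 1) ≤ d) : (gridPoly K a b m M c).natDegree ≤ d := by
  rw [gridPoly_apply]
  refine natDegree_sum_le_of_forall_le _ _ fun p _ => (natDegree_monomial_le _).trans ?_
  refine le_trans ?_ hd
  have h1 := p.1.isLt
  have h2 := p.2.isLt
  gcongr <;> omega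

lemma exists_natDegree_gridPoly {K : Type*} [Field K] {q m M : ℕ} {c : Fin m × Fin M → K}
    (h : gridPoly K 1 q m M c ≠ 0) : ∃ i j, i < m ∧ (gridPoly K 1 q m M c).natDegree = i + q * j := by
  by_contra! hc
  have h1 := leadingCoeff_ne_zero.mpr h
  apply h1
  rw [leadingCoeff]
  generalize hN : (gridPoly K 1 q m M c).natDegree = N at hc
  rw [gridPoly_apply, finsetSum_coeff]
  refine Finset.sum_eq_zero fun p _ => ?_
  rw [coeff_monomial, if_neg]
  have := hc p.1 p.2 p.1.isLt
  omega

lemma gridPoly_eq_zero_iff {K : Type*} [Field K] {q m M : ℕ} (hm : m ≤ q)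
    {c : Fin m × Fin M → K} : gridPoly K 1 q m M c = 0 ↔ c = 0 := by
  refine ⟨fun h => ?_, fun h => by simp [h]⟩
  ext p
  have h1 := congrArg (fun P => P.coeff (1 * (p.1 : ℕ) + q * (p.2 : ℕ))) h
  simp only [gridPoly_apply, finsetSum_coeff, coeff_monomial, coeff_zero] at h1
  rw [Finset.sum_eq_single p, if_pos rfl] at h1
  · exact h1
  · intro r _ hr
    rw [if_neg]
    intro he
    apply hr
    have e1 := p.1.isLt
    have e2 := r.1.isLt
    have e3 : (r.1 : ℕ) = p.1 := by
      have := congrArg (· % q) he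
      simpa [Nat.add_mul_mod_self_left, Nat.mod_eq_of_lt (e1.trans_le hm),
        Nat.mod_eq_of_lt (e2.trans_le hm)] using this
    have e4 : q * (r.2 : ℕ) = q * p.2 := by omega
    have e5 : (r.2 : ℕ) = p.2 := Nat.eq_of_mul_eq_mul_left (by omega) e4
    exact Prod.ext (Fin.ext e3) (Fin.ext e5)
  · simp

/-- The Stepanov method for a cubic over a field of order `q ^ 2`, `q = 2 * k + 3`. -/
lemma card_le_of_eval_pow_eq_neg {K : Type*} [Field K] {q k : ℕ} (hk : 1 ≤ k)
    (hq : q = 2 * k + 3) (φ : K →+* K) (hφ : ∀ x, φ x = x ^ q) (hφ2 : ∀ x, φ (φ x) = x)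
    {f : K[X]} (hf : f.natDegree = 3) (S : Finset K)
    (hS : ∀ z ∈ S, f.eval z ^ ((k + 2) * q) = - f.eval z ^ (k + 2)) :
    S.card ≤ q * (k + 2) + 4 * k + 5 := by
  classical
  have hfn : (f ^ (k + 2)).natDegree = (k + 2) * 3 := by rw [natDegree_pow, hf]
  have hf0 : f ^ (k + 2) ≠ 0 := pow_ne_zero _ (by rintro rfl; simp at hf)
  let Φ : ((Fin (k + 2) × Fin (k + 3) → K) × (Fin k × Fin (k + 3) → K)) →ₗ[K] K[X] :=
    (gridPoly K q 1 (k + 2) (k + 3)).comp (LinearMap.fst K _ _) -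
      (LinearMap.mulLeft K (f ^ (k + 2))).comp
        ((gridPoly K q 1 k (k + 3)).comp (LinearMap.snd K _ _))
  have hΦ : ∀ c, Φ c = gridPoly K q 1 (k + 2) (k + 3) c.1 -
      f ^ (k + 2) * gridPoly K q 1 k (k + 3) c.2 := fun c => rfl
  have hdeg : ∀ c, Φ c ∈ degreeLT K (2 * k ^ 2 + 6 * k + 6) := by
    intro c
    rw [mem_degreeLT, hΦ]
    refine lt_of_le_of_lt (b := ((2 * k ^ 2 + 6 * k + 5 : ℕ) : WithBot ℕ))
      (natDegree_le_iff_degree_le.mp ?_) (Nat.cast_lt.mpr (Nat.lt_succ_self _))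
    refine natDegree_sub_le_of_le (natDegree_gridPoly_le _ ?_)
      (natDegree_mul_le_of_le hfn.le (natDegree_gridPoly_le
        (d := 2 * k ^ 2 + 2 * k - 1) _ ?_)) |>.trans (max_le le_rfl ?_)
    · subst hq
      simp only [show k + 2 - 1 = k + 1 by omega,
        show k + 3 - 1 = k + 2 by omega]
      nlinarith
    · subst hq
      obtain ⟨j, rfl⟩ := Nat.exists_eq_add_of_le' hk
      simp only [Nat.add_sub_cancel, show j + 1 + 3 - 1 = j + 3 by omega]
      apply Nat.le_sub_of_add_le
      nlinarith
    · have : 1 ≤ k ^ 2 := Nat.one_le_pow _ _ hk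
      omega
  have hfin : Module.finrank K (degreeLT K (2 * k ^ 2 + 6 * k + 6)) = 2 * k ^ 2 + 6 * k + 6 := by
    rw [(degreeLTEquiv K _).finrank_eq]; simp
  have : FiniteDimensional K (degreeLT K (2 * k ^ 2 + 6 * k + 6)) :=
    LinearEquiv.finiteDimensional (degreeLTEquiv K _).symm
  have hker : LinearMap.ker (Φ.codRestrict _ hdeg) ≠ ⊥ := by
    apply LinearMap.ker_ne_bot_of_finrank_lt
    rw [hfin]
    simp only [Module.finrank_prod, Module.finrank_fintype_fun_eq_card, Fintype.card_prod,
      Fintype.card_fin]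
    nlinarith
  obtain ⟨c, hc, hc0⟩ := Submodule.exists_mem_ne_zero_of_ne_bot hker
  rw [LinearMap.ker_codRestrict, LinearMap.mem_ker, hΦ] at hc
  have hinj : ∀ x, φ x = 0 ↔ x = 0 := fun x => map_eq_zero φ
  set U := gridPoly K 1 q (k + 2) (k + 3) (fun p => φ (c.1 p)) with hU
  set V := gridPoly K 1 q k (k + 3) (fun p => φ (c.2 p)) with hV
  have hH : U + f ^ (k + 2) * V ≠ 0 := by
    intro h
    have hV0 : V = 0 := by
      by_contra hne
      have hUV : U = - (f ^ (k + 2) * V) := eq_neg_of_add_eq_zero_left h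
      have hU0 : U ≠ 0 := by
        rw [hUV]; exact neg_ne_zero.mpr (mul_ne_zero hf0 hne)
      obtain ⟨i, j, hi, hij⟩ := exists_natDegree_gridPoly hU0
      obtain ⟨i', j', hi', hij'⟩ := exists_natDegree_gridPoly hne
      have e : U.natDegree = (k + 2) * 3 + V.natDegree := by
        rw [hUV, natDegree_neg, natDegree_mul hf0 hne, hfn]
      rw [hU, hV, hij, hij'] at e
      have e2 : i + q * j = (k + 3 + i') + q * (j' + 1) := by rw [mul_add]; omega
      have := congrArg (· % q) e2
      simp only [Nat.add_mul_mod_self_left] at this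
      rw [Nat.mod_eq_of_lt (by omega), Nat.mod_eq_of_lt (by omega)] at this
      omega
    have hU0 : U = 0 := by simpa [hV0] using h
    rw [hV, gridPoly_eq_zero_iff (by omega)] at hV0
    rw [hU, gridPoly_eq_zero_iff (by omega)] at hU0
    apply hc0
    refine Prod.ext (funext fun p => ?_) (funext fun p => ?_)
    · exact (hinj _).mp (congrFun hU0 p)
    · exact (hinj _).mp (congrFun hV0 p)
  have hroot : ∀ z ∈ S, (U + f ^ (k + 2) * V).IsRoot z := by
    intro z hz
    rw [IsRoot, ← hinj]
    have key : ∀ m M (d : Fin m × Fin M → K),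
        φ ((gridPoly K 1 q m M fun p => φ (d p)).eval z) = (gridPoly K q 1 m M d).eval z := by
      intro m M d
      simp only [eval_gridPoly, map_sum, map_mul, hφ2, map_pow]
      refine Finset.sum_congr rfl fun p _ => ?_
      congr 1
      rw [pow_add, pow_add, one_mul, one_mul, pow_mul _ q, pow_mul _ q, ← hφ z, ← hφ (φ z), hφ2]
    have h0 := congrArg (eval z) hc
    simp only [eval_sub, eval_mul, eval_pow, eval_zero] at h0
    rw [eval_add, eval_mul, eval_pow, map_add, map_mul, hU, hV, key, key, hφ, ← pow_mul, hS z hz,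
      ← h0]
    ring
  have hle : (U + f ^ (k + 2) * V).natDegree ≤ q * (k + 2) + 4 * k + 5 := by
    refine natDegree_add_le_of_le (natDegree_gridPoly_le _ ?_)
      (natDegree_mul_le_of_le hfn.le (natDegree_gridPoly_le (d := q * (k + 2) + k - 1) _ ?_))
      |>.trans (max_le le_rfl ?_)
    · simp only [show k + 2 - 1 = k + 1 by omega, show k + 3 - 1 = k + 2 by omega]
      omega
    · simp only [show k + 3 - 1 = k + 2 by omega]
      omega
    · omega
  calc S.card ≤ (U + f ^ (k + 2) * V).roots.toFinset.card := by
        apply Finset.card_le_card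
        intro z hz
        rw [Multiset.mem_toFinset, mem_roots hH]
        exact hroot z hz
    _ ≤ _ := (Multiset.toFinset_card_le _).trans ((card_roots' _).trans hle)

section QuadraticCharacterSums

variable {F : Type*} [Field F] [Fintype F] [DecidableEq F]

lemma sum_comp_sq (hF : ringChar F ≠ 2) (h : F → ℤ) :
    ∑ y : F, h (y ^ 2) = ∑ w, h w * (1 + quadraticChar F w) := by
  rw [← Finset.sum_fiberwise (s := Finset.univ) (g := fun y : F => y ^ 2)]
  refine Finset.sum_congr rfl fun w _ => ?_
  have hc := quadraticChar_card_sqrts hF w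
  rw [Finset.sum_congr rfl (g := fun _ => h w)
    (fun y hy => by rw [(Finset.mem_filter.mp hy).2]), Finset.sum_const, nsmul_eq_mul, mul_comm,
    add_comm 1, ← hc]
  congr 3
  ext y
  simp

lemma sum_comp_mul_sq (hF : ringChar F ≠ 2) {l : F} (hl : quadraticChar F l = -1) (h : F → ℤ) :
    ∑ y : F, h (l * y ^ 2) = ∑ w, h w * (1 - quadraticChar F w) := by
  have hl0 : l ≠ 0 := by rintro rfl; simp at hl
  rw [sum_comp_sq hF fun w => h (l * w), 
    ← Equiv.sum_comp (Equiv.mulLeft₀ l hl0) fun w => h w * (1 - quadraticChar F w)]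
  refine Finset.sum_congr rfl fun w _ => ?_
  simp only [Equiv.mulLeft₀_apply, map_mul, hl]
  ring

lemma sum_quadraticChar_mul_add (hF : ringChar F ≠ 2) (k : F) :
    ∑ x : F, quadraticChar F (x * (x + k)) = if k = 0 then (Fintype.card F : ℤ) - 1 else -1 := by
  have key : ∀ x : F, quadraticChar F (x * (x + k)) =
      if x = 0 then 0 else quadraticChar F (1 + k * x⁻¹) := by
    intro x
    split_ifs with hx
    · simp [hx]
    · have : x * (x + k) = x ^ 2 * (1 + k * x⁻¹) := by field_simp
      rw [this, map_mul, quadraticChar_sq_one' hx, one_mul]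
  simp_rw [key]
  have h2 : ∑ x : F, (if x = 0 then 0 else quadraticChar F (1 + k * x⁻¹)) =
      ∑ x : F, (if x = 0 then 0 else quadraticChar F (1 + k * x)) := by
    rw [← Equiv.sum_comp (inv_involutive (G := F)).toPerm fun x => if x = 0 then 0 else quadraticChar F (1 + k * x)]
    simp
  rw [h2]
  have h3 : ∀ x : F, (if x = 0 then 0 else quadraticChar F (1 + k * x)) =
      quadraticChar F (1 + k * x) - if x = 0 then 1 else 0 := by
    intro x
    split_ifs with hx <;> simp [hx]
  simp_rw [h3, Finset.sum_sub_distrib, Finset.sum_ite_eq' Finset.univ (0 : F), Finset.mem_univ,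
    if_true]
  split_ifs with hk
  · simp [hk]
  · have := Equiv.sum_comp ((Equiv.mulLeft₀ k hk).trans (Equiv.addLeft (1 : F)))
      (fun x => quadraticChar F x)
    simp only [Equiv.trans_apply, Equiv.mulLeft₀_apply, Equiv.coe_addLeft] at this
    rw [this, quadraticChar_sum_zero hF]
    simp

lemma sum_sum_quadraticChar_mul_mul_add_sub_one (hF : ringChar F ≠ 2) :
    ∑ a : F, ∑ b : F, quadraticChar F (a * b * (a + b - 1)) = Fintype.card F := by
  have h1 : ∀ a : F, ∑ b : F, quadraticChar F (a * b * (a + b - 1)) =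
      (if a = 1 then (Fintype.card F : ℤ) else 0) - quadraticChar F a := by
    intro a
    have : ∀ b : F, a * b * (a + b - 1) = a * (b * (b + (a - 1))) := fun b => by ring
    simp_rw [this, map_mul _ a, ← Finset.mul_sum, sum_quadraticChar_mul_add hF, sub_eq_zero]
    split_ifs with ha <;> simp [ha]
  simp_rw [h1, Finset.sum_sub_distrib, quadraticChar_sum_zero hF]
  simp

lemma sum_sum_quadraticChar_monic_quadratic (hF : ringChar F ≠ 2) {l : F} (hl0 : l ≠ 0)
    (hl1 : l ≠ 1) :
    ∑ u : F, ∑ w : F, quadraticChar F ((u ^ 2 - w) * ((u - 1) ^ 2 - w) * ((u - l) ^ 2 - w)) =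
      Fintype.card F := by
  have h2 : (2 : F) ≠ 0 := Ring.two_ne_zero hF
  have hl1' : 1 - l ≠ 0 := sub_ne_zero.mpr hl1.symm
  rw [← sum_sum_quadraticChar_mul_mul_add_sub_one hF, ← Fintype.sum_prod_type',
    ← Fintype.sum_prod_type']
  refine Finset.sum_nbij' (fun p => ((p.1 ^ 2 - p.2) / l, ((p.1 - 1) ^ 2 - p.2) / (1 - l)))
    (fun p => ((1 + l * p.1 - (1 - l) * p.2) / 2,
      ((1 + l * p.1 - (1 - l) * p.2) / 2) ^ 2 - l * p.1)) (by simp) (by simp) ?_ ?_ ?_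
  · rintro ⟨u, w⟩ -
    ext <;> simp <;> field_simp <;> ring
  · rintro ⟨a, b⟩ -
    ext <;> simp <;> field_simp
    ring
  · rintro ⟨u, w⟩ -
    have : (u ^ 2 - w) * ((u - 1) ^ 2 - w) * ((u - l) ^ 2 - w) = (l * (1 - l)) ^ 2 *
        ((u ^ 2 - w) / l * (((u - 1) ^ 2 - w) / (1 - l)) *
          ((u ^ 2 - w) / l + ((u - 1) ^ 2 - w) / (1 - l) - 1)) := by
      field_simp
      ring
    simp only
    rw [this, map_mul, quadraticChar_sq_one' (mul_ne_zero hl0 hl1'), one_mul]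

lemma sq_sum_quadraticChar_cubic (hF : ringChar F ≠ 2) (l : F) :
    (∑ x : F, quadraticChar F (x * (x - 1) * (x - l))) ^ 2 =
      ∑ u : F, ∑ v : F, quadraticChar F
        ((u ^ 2 - v ^ 2) * ((u - 1) ^ 2 - v ^ 2) * ((u - l) ^ 2 - v ^ 2)) := by
  have h2 : (2 : F) ≠ 0 := Ring.two_ne_zero hF
  rw [sq, Finset.sum_mul_sum, ← Fintype.sum_prod_type', ← Fintype.sum_prod_type']
  refine Finset.sum_nbij' (fun p => ((p.1 + p.2) / 2, (p.1 - p.2) / 2))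
    (fun p => (p.1 + p.2, p.1 - p.2)) (by simp) (by simp) ?_ ?_ ?_
  · rintro ⟨u, w⟩ -
    ext <;> simp <;> field_simp <;> ring
  · rintro ⟨a, b⟩ -
    ext <;> simp <;> field_simp <;> ring
  · rintro ⟨x, y⟩ -
    simp only [← map_mul]
    congr 1
    field_simp
    ring

/-- The trace over the quadratic extension `F(√l)` is determined by the trace over `F`. -/
lemma sq_sum_add_sum_norm (hF : ringChar F ≠ 2) {l : F} (hl : quadraticChar F l = -1) :
    (∑ x : F, quadraticChar F (x * (x - 1) * (x - l))) ^ 2 +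
      ∑ u : F, ∑ v : F, quadraticChar F
        ((u ^ 2 - l * v ^ 2) * ((u - 1) ^ 2 - l * v ^ 2) * ((u - l) ^ 2 - l * v ^ 2)) =
      2 * Fintype.card F := by
  have hl0 : l ≠ 0 := by rintro rfl; simp at hl
  have hl1 : l ≠ 1 := by rintro rfl; simp at hl
  rw [sq_sum_quadraticChar_cubic hF, ← Finset.sum_add_distrib,
    ← sum_sum_quadraticChar_monic_quadratic hF hl0 hl1, Finset.mul_sum]
  refine Finset.sum_congr rfl fun u _ => ?_
  rw [sum_comp_sq hF fun w => quadraticChar F ((u ^ 2 - w) * ((u - 1) ^ 2 - w) * ((u - l) ^ 2 - w)),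
    sum_comp_mul_sq hF hl
      fun w => quadraticChar F ((u ^ 2 - w) * ((u - 1) ^ 2 - w) * ((u - l) ^ 2 - w)),
    ← Finset.sum_add_distrib, Finset.mul_sum]
  refine Finset.sum_congr rfl fun w _ => ?_
  ring

end QuadraticCharacterSums

lemma QuadraticAlgebra.norm_mul_sub_one_mul_sub {F : Type*} [Field F] {l : F}
    (z : QuadraticAlgebra F l 0) :
    norm (z * (z - 1) * (z - algebraMap F _ l)) = (z.re ^ 2 - l * z.im ^ 2) *
      ((z.re - 1) ^ 2 - l * z.im ^ 2) * ((z.re - l) ^ 2 - l * z.im ^ 2) := by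
  rw [map_mul, map_mul]
  simp [norm_def, algebraMap_eq]
  ring

section QuadraticExtension

variable {F : Type*} [Field F] [Fintype F] [DecidableEq F]

lemma QuadraticAlgebra.star_eq_pow_card (hF : ringChar F ≠ 2) {l : F}
    (hl : quadraticChar F l = -1) (z : QuadraticAlgebra F l 0) :
    star z = z ^ Fintype.card F := by
  have hodd := FiniteField.odd_card_of_char_ne_two hF
  have hω : (omega : QuadraticAlgebra F l 0) ^ Fintype.card F = -omega := by
    have h1 : Fintype.card F = 2 * (Fintype.card F / 2) + 1 := by omega
    rw [h1, pow_succ, pow_mul, sq, omega_mul_omega_eq_mk, ← algebraMap_eq, ← map_pow,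
      ← quadraticChar_eq_pow_of_char_ne_two' hF, hl]
    simp
  have h := congrFun (FiniteField.coe_frobeniusAlgHom F (QuadraticAlgebra F l 0)) z
  rw [← h]
  obtain ⟨x, y⟩ := z
  rw [mk_eq_add_smul_omega, map_add, map_smul, AlgHom.commutes]
  simp only [FiniteField.coe_frobeniusAlgHom, hω]
  ext <;> simp

lemma neg_le_sum_norm (hF : ringChar F ≠ 2) (h5 : 5 ≤ Fintype.card F) {l : F}
    (hl : quadraticChar F l = -1) :
    -(5 * (Fintype.card F : ℤ) + 1) ≤ ∑ u : F, ∑ v : F, quadraticChar F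
      ((u ^ 2 - l * v ^ 2) * ((u - 1) ^ 2 - l * v ^ 2) * ((u - l) ^ 2 - l * v ^ 2)) := by
  have hodd := FiniteField.odd_card_of_char_ne_two hF
  obtain ⟨k, hk⟩ : ∃ k, Fintype.card F = 2 * k + 3 := ⟨(Fintype.card F - 3) / 2, by omega⟩
  have : Fact (∀ r : F, r ^ 2 ≠ l + 0 * r) := ⟨fun r h => by
    rw [zero_mul, add_zero] at h
    exact quadraticChar_neg_one_iff_not_isSquare.mp hl ⟨r, by rw [← h, sq]⟩⟩
  let K := QuadraticAlgebra F l 0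
  let e : K ≃ F × F := QuadraticAlgebra.equivProd l 0
  let _ : Fintype K := Fintype.ofEquiv _ e.symm
  have hcard : Fintype.card K = Fintype.card F ^ 2 := by
    rw [Fintype.card_congr e, Fintype.card_prod, sq]
  let L : K := algebraMap F K l
  let f : K[X] := X * (X - C 1) * (X - C L)
  have hf : f.natDegree = 3 := by
    have h1 : (X * (X - C 1) : K[X]) ≠ 0 := mul_ne_zero X_ne_zero (X_sub_C_ne_zero _)
    rw [natDegree_mul h1 (X_sub_C_ne_zero _), natDegree_mul X_ne_zero (X_sub_C_ne_zero _),
      natDegree_X, natDegree_X_sub_C, natDegree_X_sub_C]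
  have heval : ∀ z, f.eval z = z * (z - 1) * (z - L) := fun z => by simp [f]
  let S : Finset K := {z | quadraticChar F (QuadraticAlgebra.norm (f.eval z)) = -1}
  have hSmem : ∀ z, z ∈ S ↔ quadraticChar F (QuadraticAlgebra.norm (f.eval z)) = -1 :=
    fun z => Finset.mem_filter_univ z
  have hS : S.card ≤ Fintype.card F * (k + 2) + 4 * k + 5 := by
    refine card_le_of_eval_pow_eq_neg (by omega) hk
      (FiniteField.frobeniusAlgHom F K : K →+* K) (fun x => rfl) (fun x => ?_) hf S ?_
    · change (x ^ Fintype.card F) ^ Fintype.card F = x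
      rw [← pow_mul, ← sq, ← hcard, FiniteField.pow_card]
    · intro z hz
      have hz' : quadraticChar F (QuadraticAlgebra.norm (f.eval z)) = -1 :=
        (hSmem z).mp hz
      generalize f.eval z = w at hz' ⊢
      have h1 := quadraticChar_eq_pow_of_char_ne_two' hF (QuadraticAlgebra.norm w)
      rw [hz'] at h1
      have h2 := congrArg (algebraMap F K) h1
      rw [map_pow, QuadraticAlgebra.algebraMap_norm_eq_mul_star,
        QuadraticAlgebra.star_eq_pow_card hF hl, ← pow_succ', ← pow_mul] at h2
      have h3 : (k + 2) * Fintype.card F =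
          (Fintype.card F + 1) * (Fintype.card F / 2) + (k + 2) := by
        rw [hk, show (2 * k + 3) / 2 = k + 1 by omega]
        ring
      rw [h3, pow_add, ← h2, Int.cast_neg, Int.cast_one, map_neg,
        map_one, neg_one_mul]
  have hsum : ∑ u : F, ∑ v : F, quadraticChar F
      ((u ^ 2 - l * v ^ 2) * ((u - 1) ^ 2 - l * v ^ 2) * ((u - l) ^ 2 - l * v ^ 2)) =
      ∑ z : K, quadraticChar F (QuadraticAlgebra.norm (f.eval z)) := by
    rw [← Fintype.sum_prod_type', ← e.symm.sum_comp]
    refine Finset.sum_congr rfl fun p _ => ?_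
    refine congrArg _ ?_
    rw [heval, QuadraticAlgebra.norm_mul_sub_one_mul_sub]
    rfl
  have hpt : ∀ z : K, 1 - 2 * (if z ∈ S then 1 else 0) - (if z = 0 then 1 else 0) -
      (if z = 1 then 1 else 0) - (if z = L then 1 else 0) ≤
      quadraticChar F (QuadraticAlgebra.norm (f.eval z)) := by
    intro z
    by_cases hz : f.eval z = 0
    · have hzS : z ∉ S := by simp [hSmem, hz]
      rw [hz, QuadraticAlgebra.norm_zero, quadraticChar_zero, if_neg hzS]
      rw [heval, mul_eq_zero, mul_eq_zero, sub_eq_zero, sub_eq_zero] at hz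
      rcases hz with (hz | hz) | hz <;> rw [if_pos hz] <;> split_ifs <;> norm_num
    · have hn : QuadraticAlgebra.norm (f.eval z) ≠ 0 :=
        fun h => hz (QuadraticAlgebra.norm_eq_zero_iff_eq_zero.mp h)
      rcases quadraticChar_dichotomy hn with h | h
      · rw [h]
        split_ifs <;> norm_num
      · have hzS : z ∈ S := (hSmem z).mpr h
        rw [h, if_pos hzS]
        split_ifs <;> norm_num
  have htot := Finset.sum_le_sum fun z (_ : z ∈ Finset.univ) => hpt z
  simp only [Finset.sum_sub_distrib, ← Finset.mul_sum, Finset.sum_ite_eq', Finset.sum_ite_mem,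
    Finset.univ_inter, Finset.sum_const, Finset.mem_univ, if_true, nsmul_eq_mul, mul_one,
    Finset.card_univ, hcard] at htot
  rw [hsum]
  refine le_trans ?_ htot
  have hS' : (S.card : ℤ) ≤ Fintype.card F * (k + 2) + 4 * k + 5 := by exact_mod_cast hS
  have hk' : (Fintype.card F : ℤ) = 2 * k + 3 := by exact_mod_cast hk
  push_cast
  rw [hk'] at hS' ⊢
  nlinarith

/-- A weak form of the Hasse bound for Legendre curves with non-square parameter. -/
lemma sq_sum_quadraticChar_cubic_le (hF : ringChar F ≠ 2) {l : F}
    (hl : quadraticChar F l = -1) :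
    (∑ x : F, quadraticChar F (x * (x - 1) * (x - l))) ^ 2 ≤ 9 * (Fintype.card F : ℤ) := by
  rcases le_or_gt 5 (Fintype.card F) with h5 | h5
  · have h1 := sq_sum_add_sum_norm hF hl
    have h2 := neg_le_sum_norm hF h5 hl
    have : (5 : ℤ) ≤ Fintype.card F := by exact_mod_cast h5
    linarith
  · have h1 : |∑ x : F, quadraticChar F (x * (x - 1) * (x - l))| ≤ Fintype.card F := by
      refine (Finset.abs_sum_le_sum_abs _ _).trans ?_
      refine (Finset.sum_le_card_nsmul _ _ 1 fun x _ => ?_).trans (by simp)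
      rcases quadraticChar_isQuadratic F (x * (x - 1) * (x - l)) with h | h | h <;> rw [h] <;> simp
    have h2 : (Fintype.card F : ℤ) < 5 := by exact_mod_cast h5
    rw [← sq_abs]
    nlinarith [abs_nonneg (∑ x : F, quadraticChar F (x * (x - 1) * (x - l)))]

/-- The sum of `χ((y² - c)(ly² - c))` is that of a Legendre cubic up to sign and a shift. -/
lemma sum_quadraticChar_quartic (hF : ringChar F ≠ 2) {l c : F}
    (hl : quadraticChar F l = -1) (hc : c ≠ 0) :
    ∑ y : F, quadraticChar F ((y ^ 2 - c) * (l * y ^ 2 - c)) =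
      1 + quadraticChar F c * ∑ x : F, quadraticChar F (x * (x - 1) * (x - l)) := by
  have hl0 : l ≠ 0 := by rintro rfl; simp at hl
  have hl1 : l ≠ 1 := by rintro rfl; simp at hl
  rw [sum_comp_sq hF fun w => quadraticChar F ((w - c) * (l * w - c))]
  simp only [mul_add, mul_one, Finset.sum_add_distrib]
  congr 1
  · rw [← Equiv.sum_comp (Equiv.addRight c)]
    have : ∀ t : F, (t + c - c) * (l * (t + c) - c) = l * (t * (t + (c - c / l))) := by
      intro t
      field_simp
      ring
    simp only [Equiv.coe_addRight, this]
    have hne : c - c / l ≠ 0 := by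
      rw [sub_ne_zero]
      intro h
      rw [eq_div_iff hl0] at h
      exact hl1 (mul_left_cancel₀ hc (h.trans (mul_one c).symm))
    simp only [map_mul _ l, ← Finset.mul_sum]
    rw [sum_quadraticChar_mul_add hF, if_neg hne, hl]
    norm_num
  · rw [← Equiv.sum_comp (Equiv.mulLeft₀ (c / l) (div_ne_zero hc hl0)), Finset.mul_sum]
    refine Finset.sum_congr rfl fun x _ => ?_
    simp only [Equiv.mulLeft₀_apply, ← map_mul]
    have : (c / l * x - c) * (l * (c / l * x) - c) * (c / l * x) =
        (c / l) ^ 2 * (c * (x * (x - 1) * (x - l))) := by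
      field_simp
    rw [this, map_mul, quadraticChar_sq_one' (div_ne_zero hc hl0), one_mul]

end QuadraticExtension

section EquationalGraph

variable {F : Type*} [Field F] [Fintype F] [DecidableEq F]

lemma forall_not_eqEdge_iff (hF : ringChar F ≠ 2) (l a y : F) :
    (∀ x : F, ¬ EqEdge l (X ^ 2 + X + C a) x y) ↔
      quadraticChar F (y ^ 2 - (a - 1 / 4)) = -1 ∧
        quadraticChar F (l * y ^ 2 - (a - 1 / 4)) = -1 := by
  have h2 : (2 : F) ≠ 0 := Ring.two_ne_zero hF
  have h4 : (4 : F) ≠ 0 := by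
    rw [show (4 : F) = 2 * 2 by norm_num]
    exact mul_ne_zero h2 h2
  have key : ∀ s : F, ¬ IsSquare (s - (a - 1 / 4)) ↔ ∀ x : F, s - (x ^ 2 + x + a) ≠ 0 := by
    intro s
    rw [not_iff_comm]
    push Not
    constructor
    · rintro ⟨x, hx⟩
      refine ⟨x + 1 / 2, ?_⟩
      rw [sub_eq_zero.mp hx]
      field_simp
      ring
    · rintro ⟨r, hr⟩
      refine ⟨r - 1 / 2, ?_⟩
      rw [sub_eq_iff_eq_add.mp hr]
      field_simp
      ring
  rw [quadraticChar_neg_one_iff_not_isSquare, quadraticChar_neg_one_iff_not_isSquare, key, key,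
    ← forall_and]
  refine forall_congr' fun x => ?_
  simp [EqEdge]

lemma card_sub_three_add_le (hF : ringChar F ≠ 2) {l c : F} (hl : quadraticChar F l = -1)
    (hc : c ≠ 0) :
    (Fintype.card F : ℤ) - 3 +
        quadraticChar F c * ∑ x : F, quadraticChar F (x * (x - 1) * (x - l)) ≤
      4 * (Finset.univ.filter fun y : F => quadraticChar F (y ^ 2 - c) = -1 ∧
        quadraticChar F (l * y ^ 2 - c) = -1).card := by
  have hpt : ∀ y : F, 1 - quadraticChar F (y ^ 2 - c) - quadraticChar F (l * y ^ 2 - c) +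
      quadraticChar F ((y ^ 2 - c) * (l * y ^ 2 - c)) ≤
      4 * (if quadraticChar F (y ^ 2 - c) = -1 ∧ quadraticChar F (l * y ^ 2 - c) = -1
        then 1 else 0) + 2 * (if y ^ 2 = c then 1 else 0) +
        2 * (if l * y ^ 2 = c then 1 else 0) := by
    intro y
    rw [map_mul]
    by_cases hA : y ^ 2 = c <;> by_cases hB : l * y ^ 2 = c
    · rw [sub_eq_zero.mpr hA, sub_eq_zero.mpr hB, quadraticChar_zero, if_pos hA, if_pos hB]
      split_ifs <;> norm_num
    · rcases quadraticChar_dichotomy (sub_ne_zero.mpr hB) with h | h <;>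
        rw [h, sub_eq_zero.mpr hA, quadraticChar_zero, if_pos hA, if_neg hB] <;> norm_num
    · rcases quadraticChar_dichotomy (sub_ne_zero.mpr hA) with h | h <;>
        rw [h, sub_eq_zero.mpr hB, quadraticChar_zero, if_pos hB, if_neg hA] <;> norm_num
    · rcases quadraticChar_dichotomy (sub_ne_zero.mpr hA) with h | h <;>
        rcases quadraticChar_dichotomy (sub_ne_zero.mpr hB) with h' | h' <;>
        rw [h, h', if_neg hA, if_neg hB] <;> norm_num
  have htot := Finset.sum_le_sum fun y (_ : y ∈ Finset.univ) => hpt y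
  have hlin : ∑ y : F, quadraticChar F (y ^ 2 - c) + ∑ y : F, quadraticChar F (l * y ^ 2 - c) =
      0 := by
    rw [sum_comp_sq hF fun w => quadraticChar F (w - c),
      sum_comp_mul_sq hF hl fun w => quadraticChar F (w - c), ← Finset.sum_add_distrib]
    have h := Equiv.sum_comp (Equiv.subRight c) fun w => quadraticChar F w
    simp only [Equiv.subRight_apply, quadraticChar_sum_zero hF] at h
    rw [← mul_zero 2, ← h, Finset.mul_sum]
    exact Finset.sum_congr rfl fun w _ => by ring
  have hzero : ∑ y : F, (if y ^ 2 = c then (1 : ℤ) else 0) +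
      ∑ y : F, (if l * y ^ 2 = c then (1 : ℤ) else 0) = 2 := by
    rw [sum_comp_sq hF fun w => if w = c then (1 : ℤ) else 0,
      sum_comp_mul_sq hF hl fun w => if w = c then (1 : ℤ) else 0]
    simp
  simp only [Finset.sum_sub_distrib, Finset.sum_add_distrib, ← Finset.mul_sum, Finset.sum_boole,
    sum_quadraticChar_quartic hF hl hc, Finset.sum_const, Finset.card_univ, nsmul_eq_mul,
    mul_one] at htot hzero
  linarith

end EquationalGraph

/-- for `a ≠ 1/4`, the graph `G(l, X² + X + a)` has at least
`⌊(q - 3√q)/4 - 1⌋` vertices of zero in-degree. -/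
theorem stmt16 {F : Type*} [Field F] [Fintype F]
    (hodd : Odd (Fintype.card F))
    (l : F) (hl : ∀ z : F, z ^ 2 ≠ l)
    (a : F) (ha : a ≠ 1 / 4) :
    ⌊((Fintype.card F : ℝ) - 3 * Real.sqrt (Fintype.card F)) / 4 - 1⌋ ≤
      (Set.ncard {y : F | ∀ x : F, ¬ EqEdge l (X ^ 2 + X + C a) x y} : ℤ) := by
  classical
  have hF : ringChar F ≠ 2 := fun h => by
    have := FiniteField.even_card_iff_char_two.mp h
    rw [Nat.odd_iff] at hodd
    omega
  have hl' : quadraticChar F l = -1 := quadraticChar_neg_one_iff_not_isSquare.mpr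
    fun ⟨z, hz⟩ => hl z (by rw [hz, sq])
  have hcard := card_sub_three_add_le hF hl' (sub_ne_zero.mpr ha)
  have hset : Set.ncard {y : F | ∀ x : F, ¬ EqEdge l (X ^ 2 + X + C a) x y} =
      (Finset.univ.filter fun y : F => quadraticChar F (y ^ 2 - (a - 1 / 4)) = -1 ∧
        quadraticChar F (l * y ^ 2 - (a - 1 / 4)) = -1).card := by
    rw [← Set.ncard_coe_finset]
    congr 1
    ext y
    rw [Set.mem_ofPred_eq, forall_not_eqEdge_iff hF, Finset.mem_coe, Finset.mem_filter_univ]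
  rw [hset]
  generalize (Finset.univ.filter fun y : F => quadraticChar F (y ^ 2 - (a - 1 / 4)) = -1 ∧
    quadraticChar F (l * y ^ 2 - (a - 1 / 4)) = -1).card = N at hcard
  have hT := sq_sum_quadraticChar_cubic_le hF hl'
  generalize ∑ x : F, quadraticChar F (x * (x - 1) * (x - l)) = T at hcard hT
  have hT' : |(T : ℝ)| ≤ 3 * Real.sqrt (Fintype.card F) := by
    apply abs_le_of_sq_le_sq _ (by positivity)
    rw [mul_pow, Real.sq_sqrt (Nat.cast_nonneg _)]
    have : ((T ^ 2 : ℤ) : ℝ) ≤ ((9 * Fintype.card F : ℤ) : ℝ) := Int.cast_le.mpr hT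
    push_cast at this
    linarith
  rw [abs_le] at hT'
  have hcard' : (Fintype.card F : ℝ) - 3 + quadraticChar F (a - 1 / 4) * T ≤ 4 * N := by
    exact_mod_cast hcard
  have hx : (-3 : ℝ) * Real.sqrt (Fintype.card F) ≤ quadraticChar F (a - 1 / 4) * T := by
    rcases quadraticChar_dichotomy (sub_ne_zero.mpr ha) with h | h <;> rw [h] <;> push_cast <;>
      linarith
  have hfloor := Int.floor_le (((Fintype.card F : ℝ) - 3 * Real.sqrt (Fintype.card F)) / 4 - 1)
  have : ((⌊((Fintype.card F : ℝ) - 3 * Real.sqrt (Fintype.card F)) / 4 - 1⌋ : ℤ) : ℝ) ≤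
      ((N : ℤ) : ℝ) := by
    push_cast
    linarith
  exact_mod_cast this
end

section
/- Let F_q be a finite field of odd order q, let λ ∈ F_q be a non-square element, and let a ∈ F_q with a ≠ 1/4. Then the weakly connected component of the vertex 0 in the equational graph G(λ, X² + X + a) does not have a Hamiltonian cycle. Similarly, for any a ∈ F_q with a ≠ 0, the weakly connected component of the vertex 0 in G(λ, X² + a) does not have a Hamiltonian cycle. -/
open Polynomial

theorem eval_eq_zero_of_eqEdge_zero {F : Type*} [Field F] {l : F} {f : Polynomial F} {x : F}
    (h : EqEdge l f x 0) : f.eval x = 0 := by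
  simpa [EqEdge] using h

theorem eqEdge_zero_of_eval_eq_zero {F : Type*} [Field F] (l : F) {f : Polynomial F} {x : F}
    (h : f.eval x = 0) : EqEdge l f x 0 := by
  simp [EqEdge, h]

theorem eq_zero_of_eqEdge {F : Type*} [Field F] {l : F} (hl : l ≠ 0) {f : Polynomial F} {x y : F}
    (hx : f.eval x = 0) (h : EqEdge l f x y) : y = 0 := by
  simpa [EqEdge, hx, hl] using h

/-- If every root of `f` comes with a second, distinct root, then the component of `0` in
`G(l, f)` has no Hamiltonian cycle: all roots have `0` as their only out-neighbour. -/
theorem not_exists_hamiltonian_cycle {F : Type*} [Field F] {l : F} (hl : l ≠ 0)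
    {f : Polynomial F} (hf : ∀ r, f.eval r = 0 → ∃ s, s ≠ r ∧ f.eval s = 0) :
    ¬ ∃ (n : ℕ) (v : ZMod n → F),
      IsCycle (EqEdge l f) n v ∧ Set.range v = WeakComp (EqEdge l f) 0 := by
  rintro ⟨n, v, ⟨-, hinj, hedge⟩, hrange⟩
  have h0 : (0 : F) ∈ Set.range v := hrange ▸ Relation.ReflTransGen.refl
  obtain ⟨i, hi⟩ := h0
  have hpred : EqEdge l f (v (i - 1)) 0 := by
    simpa [hi] using hedge (i - 1)
  obtain ⟨s, hne, hs⟩ := hf _ (eval_eq_zero_of_eqEdge_zero hpred)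
  have hmem : s ∈ Set.range v :=
    hrange ▸ Relation.ReflTransGen.single (Or.inr (eqEdge_zero_of_eval_eq_zero l hs))
  obtain ⟨j, rfl⟩ := hmem
  have hj : j + 1 = i := hinj ((eq_zero_of_eqEdge hl hs (hedge j)).trans hi.symm)
  exact hne (by rw [← hj, add_sub_cancel_right])

/-- for `a ≠ 1/4`, the weakly connected component of the vertex `0` in
`G(l, X² + X + a)` has no Hamiltonian cycle; similarly for `a ≠ 0` and `G(l, X² + a)`. -/
theorem stmt17 {F : Type*} [Field F] [Fintype F]
    (hodd : Odd (Fintype.card F))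
    (l : F) (hl : ∀ z : F, z ^ 2 ≠ l) :
    (∀ a : F, a ≠ 1 / 4 →
      ¬ ∃ (n : ℕ) (v : ZMod n → F),
        IsCycle (EqEdge l (X ^ 2 + X + C a)) n v ∧
        Set.range v = WeakComp (EqEdge l (X ^ 2 + X + C a)) 0) ∧
    (∀ a : F, a ≠ 0 →
      ¬ ∃ (n : ℕ) (v : ZMod n → F),
        IsCycle (EqEdge l (X ^ 2 + C a)) n v ∧
        Set.range v = WeakComp (EqEdge l (X ^ 2 + C a)) 0) := by
  have hl0 : l ≠ 0 := fun h => hl 0 (by simp [h])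
  have h2 : (2 : F) ≠ 0 := Ring.two_ne_zero fun h =>
    Nat.not_even_iff_odd.2 hodd (FiniteField.even_card_iff_char_two.1 h |> Nat.even_iff.2)
  refine ⟨fun a ha => not_exists_hamiltonian_cycle hl0 fun r hr => ?_,
    fun a ha => not_exists_hamiltonian_cycle hl0 fun r hr => ?_⟩ <;>
  simp only [eval_add, eval_pow, eval_X, eval_C] at hr ⊢
  · refine ⟨-1 - r, fun h => ha ?_, by linear_combination hr⟩
    have h4 : (4 : F) ≠ 0 := by
      simpa [show (4 : F) = 2 * 2 by norm_num] using h2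
    rw [eq_div_iff h4]
    linear_combination 4 * hr + (2 * r + 1) * h
  · refine ⟨-r, fun h => ha ?_, by linear_combination hr⟩
    have hr0 : r = 0 := (mul_eq_zero.1 (by linear_combination -h : 2 * r = 0)).resolve_left h2
    simpa [hr0] using hr
end

section
/- Let F_q be a finite field of odd order q with 3 | q − 1, let λ ∈ F_q be a non-square element, and let a ∈ F_q. Then the equational graph G(λ, X³ + a) has at least N vertices of zero in-degree, where N = (q − 1)/3 if −a is a cube in F_q and N = (q − 7)/3 otherwise. In particular, G(λ, X³ + a) always has at least one vertex of zero in-degree. -/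
open Polynomial

/-- The vertices `y` reached from some `x` with `f(x) = v`. -/
noncomputable def sqFiber {F : Type*} [Field F] [Fintype F] [DecidableEq F]
    (l v : F) : Finset F :=
  Finset.univ.filter fun y => y ^ 2 = v ∨ l * y ^ 2 = v

theorem sqFiber_card_le_two {F : Type*} [Field F] [Fintype F] [DecidableEq F]
    {l : F} (hl : ∀ z : F, z ^ 2 ≠ l) (v : F) : (sqFiber l v).card ≤ 2 := by
  have hl0 : l ≠ 0 := fun h => hl 0 (by simp [h])
  have key : ∀ y z : F, y ^ 2 = v → l * z ^ 2 = v → z = y ∨ z = -y := by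
    intro y z hy hz
    by_cases h0 : z = 0
    · subst h0
      have : y ^ 2 = 0 := by rw [hy, ← hz]; ring
      left
      exact (pow_eq_zero_iff two_ne_zero |>.1 this).symm
    · refine absurd ?_ (hl (y / z))
      rw [div_pow, hy, ← hz]
      field_simp
  rcases (sqFiber l v).eq_empty_or_nonempty with h | ⟨y, hy⟩
  · simp [h]
  · refine (Finset.card_le_card (t := {y, -y}) ?_).trans Finset.card_le_two
    intro z hz
    simp only [sqFiber, Finset.mem_filter, Finset.mem_univ, true_and] at hy hz
    simp only [Finset.mem_insert, Finset.mem_singleton]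
    rcases hy with hy | hy <;> rcases hz with hz | hz
    · exact sq_eq_sq_iff_eq_or_eq_neg.1 (hz.trans hy.symm)
    · exact key y z hy hz
    · rcases key z y hz hy with h | h
      · exact Or.inl h.symm
      · exact Or.inr (by rw [h, neg_neg])
    · exact sq_eq_sq_iff_eq_or_eq_neg.1 (mul_left_cancel₀ hl0 (hz.trans hy.symm))

theorem card_cubes_add_le {F : Type*} [Field F] [Fintype F] [DecidableEq F]
    (h3 : 3 ∣ (Fintype.card F - 1)) (a : F) :
    3 * (Finset.univ.image fun x : F => x ^ 3 + a).card ≤ Fintype.card F + 2 := by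
  obtain ⟨u, hu⟩ : ∃ u : Fˣ, orderOf u = 3 := by
    have : Fact (Nat.Prime 3) := ⟨Nat.prime_three⟩
    exact exists_prime_orderOf_dvd_card 3 (by rwa [Fintype.card_units])
  have hw3 : (u : F) ^ 3 = 1 := by
    have := pow_orderOf_eq_one u
    rw [hu] at this
    rw [← Units.val_pow_eq_pow_val, this, Units.val_one]
  have hw1 : (u : F) ≠ 1 := by
    intro h
    have : u = 1 := Units.ext h
    simp [this] at hu
  set w : F := (u : F)
  have hw0 : w ≠ 0 := u.ne_zero
  have hfib : ∀ v ∈ (Finset.univ.erase (0 : F)).image (fun x : F => x ^ 3 + a),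
      3 ≤ ((Finset.univ.erase (0 : F)).filter fun x => x ^ 3 + a = v).card := by
    intro v hv
    obtain ⟨x, hx, rfl⟩ := Finset.mem_image.1 hv
    have hx0 : x ≠ 0 := Finset.ne_of_mem_erase hx
    have hcard : ({x, w * x, w ^ 2 * x} : Finset F).card = 3 := by
      rw [Finset.card_eq_three]
      refine ⟨x, w * x, w ^ 2 * x, ?_, ?_, ?_, rfl⟩
      · intro h
        exact hw1 (mul_right_cancel₀ hx0 (by rw [← h, one_mul]))
      · intro h
        have h2 : w ^ 2 = 1 := mul_right_cancel₀ hx0 (by rw [← h, one_mul])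
        exact hw1 (by rw [← hw3, pow_succ, h2, one_mul])
      · intro h
        have h2 : w = w ^ 2 := mul_right_cancel₀ hx0 h
        exact hw1 (mul_left_cancel₀ hw0 (by rw [← sq, ← h2, mul_one]))
    refine hcard.symm.le.trans (Finset.card_le_card ?_)
    intro z hz
    simp only [Finset.mem_insert, Finset.mem_singleton] at hz
    simp only [Finset.mem_filter, Finset.mem_erase, Finset.mem_univ, and_true]
    rcases hz with rfl | rfl | rfl
    · exact ⟨hx0, rfl⟩
    · exact ⟨mul_ne_zero hw0 hx0, by rw [mul_pow, hw3, one_mul]⟩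
    · refine ⟨mul_ne_zero (pow_ne_zero _ hw0) hx0, ?_⟩
      rw [mul_pow, ← pow_mul, mul_comm 2 3, pow_mul, hw3, one_pow, one_mul]
  have hsum := Finset.card_nsmul_le_sum _ _ 3 hfib
  rw [← Finset.card_eq_sum_card_image, Finset.card_erase_of_mem (Finset.mem_univ _),
    Finset.card_univ, smul_eq_mul] at hsum
  have himg : (Finset.univ.image fun x : F => x ^ 3 + a).card ≤
      ((Finset.univ.erase (0 : F)).image fun x : F => x ^ 3 + a).card + 1 := by
    rw [← Finset.insert_erase (Finset.mem_univ (0 : F)), Finset.image_insert]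
    simp
  have := Fintype.card_pos (α := F)
  omega

theorem mem_biUnion_sqFiber_iff {F : Type*} [Field F] [Fintype F] [DecidableEq F]
    (l a y : F) :
    y ∈ (Finset.univ.image fun x : F => x ^ 3 + a).biUnion (sqFiber l) ↔
      ∃ x, EqEdge l (X ^ 3 + C a) x y := by
  simp [sqFiber, EqEdge, sub_eq_zero]

theorem ncard_zero_inDegree {F : Type*} [Field F] [Fintype F] [DecidableEq F]
    (l a : F) :
    Set.ncard {y : F | ∀ x : F, ¬ EqEdge l (X ^ 3 + C a) x y} =
      Fintype.card F -
        ((Finset.univ.image fun x : F => x ^ 3 + a).biUnion (sqFiber l)).card := by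
  rw [← Finset.card_compl, ← Set.ncard_coe_finset]
  congr 1
  ext y
  rw [Finset.mem_coe, Finset.mem_compl, mem_biUnion_sqFiber_iff]
  simp

/-- if `3 ∣ q - 1`, then `G(l, X³ + a)` has at least `N` vertices of zero
in-degree, with `N = (q-1)/3` if `-a` is a cube and `N = (q-7)/3` otherwise; in
particular it always has at least one vertex of zero in-degree. -/
theorem stmt18 {F : Type*} [Field F] [Fintype F]
    (hodd : Odd (Fintype.card F)) (h3 : 3 ∣ (Fintype.card F - 1))
    (l : F) (hl : ∀ z : F, z ^ 2 ≠ l)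
    (a : F) :
    ((∃ x : F, x ^ 3 = -a) →
      (Fintype.card F - 1) / 3 ≤
        Set.ncard {y : F | ∀ x : F, ¬ EqEdge l (X ^ 3 + C a) x y}) ∧
    (¬(∃ x : F, x ^ 3 = -a) →
      (Fintype.card F - 7) / 3 ≤
        Set.ncard {y : F | ∀ x : F, ¬ EqEdge l (X ^ 3 + C a) x y}) ∧
    (∃ y : F, ∀ x : F, ¬ EqEdge l (X ^ 3 + C a) x y) := by
  classical
  have hS := card_cubes_add_le h3 a
  have hN := ncard_zero_inDegree l a
  set S : Finset F := Finset.univ.image fun x : F => x ^ 3 + a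
  have hT := Finset.card_biUnion_le_card_mul S (sqFiber l) 2
    fun v _ => sqFiber_card_le_two hl v
  have hq : 1 < Fintype.card F := Fintype.one_lt_card
  have h7 : 7 ≤ Fintype.card F := by
    obtain ⟨k, hk⟩ := hodd
    omega
  refine ⟨?_, ?_, ?_⟩
  · rintro ⟨x, hx⟩
    have h0 : (0 : F) ∈ S := Finset.mem_image.2 ⟨x, Finset.mem_univ _, by simp [hx]⟩
    have hl0 : l ≠ 0 := fun h => hl 0 (by simp [h])
    have hsing : sqFiber l 0 = {0} := by
      ext y
      simp [sqFiber, hl0]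
    have hE := Finset.card_biUnion_le_card_mul (S.erase 0) (sqFiber l) 2
      fun v _ => sqFiber_card_le_two hl v
    have hB : (S.biUnion (sqFiber l)).card ≤ 1 + ((S.erase 0).biUnion (sqFiber l)).card := by
      rw [← Finset.insert_erase h0, Finset.biUnion_insert, hsing,
        Finset.erase_insert (Finset.notMem_erase _ _)]
      exact Finset.card_union_le _ _
    rw [Finset.card_erase_of_mem h0] at hE
    omega
  · intro _
    omega
  · have hpos : 0 < Set.ncard {y : F | ∀ x : F, ¬ EqEdge l (X ^ 3 + C a) x y} := by omega
    exact Set.nonempty_of_ncard_ne_zero hpos.ne'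
end

section
/- Let F_q be a finite field of odd order q with 3 ∤ q − 1 and let λ ∈ F_q be a non-square element. For any a ∈ F_q with a ≠ 0: (i) the equational graph G(λ, X³ + a) has a weakly connected component with exactly two vertices if and only if λ ≠ −1 and a = (λ + 1)(λ − 1)²/8, in which case the vertices (1 − λ)/2 and (λ − 1)/2 form such a component; and (ii) G(λ, X³ + a) has no weakly connected component with exactly four vertices. -/
open Polynomial

theorem cube_injective_of_not_three_dvd {F : Type*} [Field F] [Fintype F]
    (h3 : ¬ (3 ∣ (Fintype.card F - 1))) : Function.Injective fun x : F => x ^ 3 := by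
  classical
  intro u v h
  simp only at h
  by_cases hu : u = 0
  · subst hu
    exact (by simpa using h.symm : v = 0).symm
  by_cases hv : v = 0
  · subst hv
    simpa using h
  have hc : (Nat.card Fˣ).Coprime 3 := by
    rw [Nat.card_eq_fintype_card, Fintype.card_units]
    exact ((Nat.Prime.coprime_iff_not_dvd Nat.prime_three).2 h3).symm
  have key : powCoprime hc (Units.mk0 u hu) = powCoprime hc (Units.mk0 v hv) := by
    ext
    simpa using h
  simpa using congrArg Units.val ((powCoprime hc).injective key)

theorem exists_sq_or_nonsquare_mul_sq {F : Type*} [Field F] [Fintype F]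
    {l : F} (hl : ∀ z : F, z ^ 2 ≠ l) (c : F) :
    ∃ s : F, s ^ 2 = c ∨ l * s ^ 2 = c := by
  classical
  by_cases hc : IsSquare c
  · obtain ⟨s, rfl⟩ := hc
    exact ⟨s, Or.inl (sq s)⟩
  have hl0 : l ≠ 0 := fun h => hl 0 (by simp [h])
  have hlsq : ¬ IsSquare l := fun ⟨s, hs⟩ => hl s (by rw [hs, sq])
  have hc0 : c ≠ 0 := fun h => hc (h ▸ IsSquare.zero)
  have hχ : quadraticChar F (c * l) = 1 := by
    rw [map_mul, quadraticChar_neg_one_iff_not_isSquare.2 hc,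
      quadraticChar_neg_one_iff_not_isSquare.2 hlsq]
    norm_num
  obtain ⟨s, hs⟩ := (quadraticChar_one_iff_isSquare (mul_ne_zero hc0 hl0)).1 hχ
  refine ⟨s / l, Or.inr ?_⟩
  field_simp
  linear_combination -hs

theorem two_ne_zero_of_odd_card {F : Type*} [Field F] [Fintype F]
    (hodd : Odd (Fintype.card F)) : (2 : F) ≠ 0 := by
  refine Ring.two_ne_zero fun h => ?_
  have := FiniteField.even_card_iff_char_two.1 h
  rw [Nat.odd_iff] at hodd
  omega

theorem eqEdge_cube_iff {F : Type*} [Field F] {l a x y : F} :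
    EqEdge l (X ^ 3 + C a) x y ↔ y ^ 2 = x ^ 3 + a ∨ l * y ^ 2 = x ^ 3 + a := by
  simp [EqEdge, sub_eq_zero]

theorem WeakComp.mem_of_edge {V : Type*} {E : V → V → Prop} {x u v : V}
    (hu : u ∈ WeakComp E x) (h : E u v) : v ∈ WeakComp E x :=
  Relation.ReflTransGen.tail hu (Or.inl h)

theorem WeakComp.mem_of_edge_to {V : Type*} {E : V → V → Prop} {x u v : V}
    (hu : u ∈ WeakComp E x) (h : E v u) : v ∈ WeakComp E x :=
  Relation.ReflTransGen.tail hu (Or.inr h)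

theorem WeakComp.neg_mem {F : Type*} [Field F] [Fintype F]
    (h3 : ¬ (3 ∣ (Fintype.card F - 1))) {l a x v : F}
    (hv : v ∈ WeakComp (EqEdge l (X ^ 3 + C a)) x) :
    -v ∈ WeakComp (EqEdge l (X ^ 3 + C a)) x := by
  obtain ⟨w, hw⟩ :=
    Finite.surjective_of_injective (cube_injective_of_not_three_dvd h3) (v ^ 2 - a)
  simp only at hw
  refine mem_of_edge (mem_of_edge_to hv (v := w) ?_) ?_ <;>
    exact eqEdge_cube_iff.2 (Or.inl (by rw [hw]; ring))

theorem eq_pair_neg_of_ncard_eq_two {F : Type*} [Field F] (h2 : (2 : F) ≠ 0) {K : Set F}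
    (hneg : ∀ v ∈ K, -v ∈ K) (hK : K.ncard = 2) : ∃ x ≠ 0, K = {x, -x} := by
  obtain ⟨u, v, huv, rfl⟩ := Set.ncard_eq_two.1 hK
  have hself : ∀ z : F, -z = z → z = 0 := fun z hz =>
    (mul_eq_zero.1 (show 2 * z = 0 by linear_combination -hz)).resolve_left h2
  have hu := hneg u (by simp)
  have hv := hneg v (by simp)
  simp only [Set.mem_insert_iff, Set.mem_singleton_iff] at hu hv
  rcases hu with hu | hu
  · have hu0 := hself u hu
    rcases hv with hv | hv
    · exact absurd (neg_injective (hu.trans hv.symm)) huv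
    · exact absurd (by rw [hu0, hself v hv]) huv
  · refine ⟨u, ?_, by rw [hu]⟩
    rintro rfl
    exact huv (by simpa using hu)

theorem eq_two_pairs_neg_of_ncard_eq_four {F : Type*} [Field F] (h2 : (2 : F) ≠ 0) {K : Set F}
    (hneg : ∀ v ∈ K, -v ∈ K) (hK : K.ncard = 4) :
    ∃ x y : F, x ≠ 0 ∧ y ≠ 0 ∧ x ^ 2 ≠ y ^ 2 ∧ K = {x, -x, y, -y} := by
  have hfin : K.Finite := Set.finite_of_ncard_ne_zero (by omega)
  obtain ⟨x, hx, hx0⟩ := Set.exists_ne_of_one_lt_ncard (s := K) (by omega) 0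
  have hxx : x ≠ -x := fun h =>
    hx0 ((mul_eq_zero.1 (show 2 * x = 0 by linear_combination h)).resolve_left h2)
  have hsub : ({x, -x} : Set F) ⊆ K := by
    rintro z (rfl | rfl)
    exacts [hx, hneg _ hx]
  have hcard := Set.ncard_sdiff_add_ncard_of_subset hsub hfin
  rw [Set.ncard_pair hxx, hK] at hcard
  obtain ⟨y, hy0, hy⟩ := eq_pair_neg_of_ncard_eq_two h2 (K := K \ {x, -x}) (by
    rintro v ⟨hv, hv'⟩
    refine ⟨hneg v hv, fun h => hv' ?_⟩
    rcases h with h | h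
    · exact Or.inr (by rw [← h, neg_neg]; rfl)
    · exact Or.inl (neg_injective h)) (by omega)
  refine ⟨x, y, hx0, hy0, fun h => ?_, ?_⟩
  · have hyK : y ∈ K \ {x, -x} := by simp [hy]
    apply hyK.2
    rcases sq_eq_sq_iff_eq_or_eq_neg.1 h with h | h
    · exact Or.inl h.symm
    · exact Or.inr (by rw [h, neg_neg]; rfl)
  · rw [← Set.union_sdiff_cancel hsub, hy]
    simp only [Set.insert_union, Set.singleton_union]

theorem false_of_pair_sums {F : Type*} [Field F] {A B l c p q r s : F}
    (hc : c ≠ 0) (hAB : A ≠ B) (hl : l ≠ 1)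
    (hpq : p + q = c) (hrs : r + s = c)
    (hne : p ≠ q) (hne' : r ≠ s) (h13 : p ≠ r) (h14 : p ≠ s) (h23 : q ≠ r) (h24 : q ≠ s)
    (hp : p = A ∨ p = l * A ∨ p = B ∨ p = l * B) (hq : q = A ∨ q = l * A ∨ q = B ∨ q = l * B)
    (hr : r = A ∨ r = l * A ∨ r = B ∨ r = l * B) (hs : s = A ∨ s = l * A ∨ s = B ∨ s = l * B) :
    False := by
  have e1 : A + l * A = c → B + l * B = c → False := fun h h' => by
    have : (1 + l) * (A - B) = 0 := by linear_combination h - h'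
    rcases mul_eq_zero.1 this with h0 | h0
    · exact hc (by linear_combination A * h0 - h)
    · exact hAB (sub_eq_zero.1 h0)
  have e2 : A + B = c → l * A + l * B = c → False := fun h h' => by
    have : (1 - l) * (A + B) = 0 := by linear_combination h - h'
    rcases mul_eq_zero.1 this with h0 | h0
    · exact hl (by linear_combination -h0)
    · exact hc (by linear_combination h0 - h)
  have e3 : A + l * B = c → l * A + B = c → False := fun h h' => by
    have : (1 - l) * (A - B) = 0 := by linear_combination h - h'
    rcases mul_eq_zero.1 this with h0 | h0
    · exact hl (by linear_combination -h0)
    · exact hAB (sub_eq_zero.1 h0)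
  grind

theorem weakComp_cube_eq_pair {F : Type*} [Field F] [Fintype F]
    (h3 : ¬ (3 ∣ (Fintype.card F - 1))) {l a x : F} (hl : ∀ z : F, z ^ 2 ≠ l) (hx : x ≠ 0)
    (hpos : x ^ 3 + a = x ^ 2) (hneg : (-x) ^ 3 + a = l * x ^ 2) :
    WeakComp (EqEdge l (X ^ 3 + C a)) x = {x, -x} := by
  have hl0 : l ≠ 0 := fun h => hl 0 (by simp [h])
  have hinj : ∀ u v : F, u ^ 3 + a = v ^ 3 + a → u = v := fun u v h =>
    cube_injective_of_not_three_dvd h3 (add_right_cancel h)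
  have hns : ∀ u v : F, v ≠ 0 → u ^ 2 ≠ l * v ^ 2 := fun u v hv h =>
    hl (u / v) (by field_simp; linear_combination h)
  ext y
  constructor
  · intro hy
    induction hy with
    | refl => simp
    | @tail u v _ huv ih =>
      have hu2 : u ^ 2 = x ^ 2 := by
        rcases ih with rfl | rfl
        · rfl
        · ring
      rw [eqEdge_cube_iff, eqEdge_cube_iff, hu2] at huv
      rcases huv with huv | huv
      · suffices v ^ 2 = x ^ 2 from sq_eq_sq_iff_eq_or_eq_neg.1 this
        rcases ih with rfl | rfl
        · rw [hpos] at huv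
          refine huv.resolve_right fun h => hns u v ?_ h.symm
          rintro rfl
          exact hx (by simpa using h.symm)
        · rw [hneg] at huv
          exact mul_left_cancel₀ hl0 (huv.resolve_left (hns v x hx))
      · rcases huv with huv | huv
        · exact Or.inl (hinj v x (by rw [hpos, huv]))
        · exact Or.inr (hinj v (-x) (by rw [hneg, huv]))
  · rintro (rfl | rfl)
    · exact Relation.ReflTransGen.refl
    · exact Relation.ReflTransGen.single
        (Or.inl (eqEdge_cube_iff.2 (Or.inl (by rw [hpos]; ring))))

/-- assume `3 ∤ q - 1` and `a ≠ 0`. Then (i) `G(l, X³ + a)` has a weakly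
connected component with exactly two vertices iff `l ≠ -1` and `a = (l+1)(l-1)²/8`, in
which case the vertices `(1-l)/2` and `(l-1)/2` form such a component; and (ii)
`G(l, X³ + a)` has no weakly connected component with exactly four vertices. -/
theorem stmt19 {F : Type*} [Field F] [Fintype F]
    (hodd : Odd (Fintype.card F)) (h3 : ¬ (3 ∣ (Fintype.card F - 1)))
    (l : F) (hl : ∀ z : F, z ^ 2 ≠ l)
    (a : F) (ha : a ≠ 0) :
    ((∃ x : F, Set.ncard (WeakComp (EqEdge l (X ^ 3 + C a)) x) = 2) ↔
      (l ≠ -1 ∧ a = (l + 1) * (l - 1) ^ 2 / 8)) ∧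
    (l ≠ -1 → a = (l + 1) * (l - 1) ^ 2 / 8 →
      WeakComp (EqEdge l (X ^ 3 + C a)) ((1 - l) / 2) = {(1 - l) / 2, (l - 1) / 2}) ∧
    (¬ ∃ x : F, Set.ncard (WeakComp (EqEdge l (X ^ 3 + C a)) x) = 4) := by
  have h2 := two_ne_zero_of_odd_card hodd
  have h8 : (8 : F) ≠ 0 := by
    have := pow_ne_zero 3 h2
    norm_num at this
    exact this
  have hl1 : l ≠ 1 := fun h => hl 1 (by simp [h])
  have hinj : ∀ u v : F, u ^ 3 + a = v ^ 3 + a → u = v := fun u v h =>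
    cube_injective_of_not_three_dvd h3 (add_right_cancel h)
  have hself : ∀ z : F, z ≠ 0 → z ≠ -z := fun z hz h =>
    hz ((mul_eq_zero.1 (show 2 * z = 0 by linear_combination h)).resolve_left h2)
  have hout : ∀ x u : F, u ∈ WeakComp (EqEdge l (X ^ 3 + C a)) x →
      ∃ s ∈ WeakComp (EqEdge l (X ^ 3 + C a)) x, u ^ 3 + a = s ^ 2 ∨ u ^ 3 + a = l * s ^ 2 := by
    intro x u hu
    obtain ⟨s, hs⟩ := exists_sq_or_nonsquare_mul_sq hl (u ^ 3 + a)
    exact ⟨s, WeakComp.mem_of_edge hu (eqEdge_cube_iff.2 hs), hs.imp Eq.symm Eq.symm⟩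
  have hx0 : (1 - l) / 2 ≠ 0 := div_ne_zero (sub_ne_zero.2 hl1.symm) h2
  have hxneg : (l - 1) / 2 = -((1 - l) / 2) := by ring
  have hcomp : a = (l + 1) * (l - 1) ^ 2 / 8 →
      WeakComp (EqEdge l (X ^ 3 + C a)) ((1 - l) / 2) = {(1 - l) / 2, (l - 1) / 2} := by
    intro h
    rw [hxneg]
    refine weakComp_cube_eq_pair h3 hl hx0 ?_ ?_ <;>
    · rw [h, show (8 : F) = 2 ^ 3 by norm_num]
      field_simp
      ring
  refine ⟨⟨?_, fun ⟨_, h⟩ => ⟨_, by rw [hcomp h, hxneg, Set.ncard_pair (hself _ hx0)]⟩⟩,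
    fun _ => hcomp, ?_⟩
  · rintro ⟨x, hx⟩
    obtain ⟨u, hu0, hK⟩ := eq_pair_neg_of_ncard_eq_two h2 (fun v => WeakComp.neg_mem h3) hx
    have hval : ∀ t ∈ ({u, -u} : Set F), t ^ 3 + a = u ^ 2 ∨ t ^ 3 + a = l * u ^ 2 := by
      intro t ht
      obtain ⟨s, hs, hts⟩ := hout x t (hK ▸ ht)
      rw [hK] at hs
      have hs2 : s ^ 2 = u ^ 2 := sq_eq_sq_iff_eq_or_eq_neg.2 hs
      rwa [hs2] at hts
    have hformula : ∀ v : F, v ≠ 0 → v ^ 3 + a = v ^ 2 → (-v) ^ 3 + a = l * v ^ 2 →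
        a = (l + 1) * (l - 1) ^ 2 / 8 := by
      intro v hv h h'
      have hv' : 2 * v = 1 - l := mul_right_cancel₀ (pow_ne_zero 2 hv) (by
        linear_combination h - h')
      rw [eq_div_iff h8]
      have hl' : l = 1 - 2 * v := by linear_combination hv'
      subst hl'
      linear_combination 8 * h
    have ha' : a = (l + 1) * (l - 1) ^ 2 / 8 := by
      rcases hval u (by simp) with h | h <;> rcases hval (-u) (by simp) with h' | h'
      · exact absurd (hinj _ _ (h.trans h'.symm)) (hself u hu0)
      · exact hformula u hu0 h h'
      · exact hformula (-u) (neg_ne_zero.2 hu0) (by rw [h']; ring) (by rw [neg_neg, h]; ring)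
      · exact absurd (hinj _ _ (h.trans h'.symm)) (hself u hu0)
    refine ⟨?_, ha'⟩
    rintro rfl
    exact ha (by rw [ha']; simp)
  · rintro ⟨w, hw⟩
    obtain ⟨x, y, hx, hy, hxy, hK⟩ :=
      eq_two_pairs_neg_of_ncard_eq_four h2 (fun v => WeakComp.neg_mem h3) hw
    have hval : ∀ t ∈ ({x, -x, y, -y} : Set F), t ^ 3 + a = x ^ 2 ∨ t ^ 3 + a = l * x ^ 2 ∨
        t ^ 3 + a = y ^ 2 ∨ t ^ 3 + a = l * y ^ 2 := by
      intro t ht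
      obtain ⟨s, hs, hts⟩ := hout w t (hK ▸ ht)
      rw [hK] at hs
      rcases hs with rfl | rfl | rfl | rfl <;> (try rw [neg_sq] at hts) <;> tauto
    have hne : ∀ u v : F, u ≠ v → u ^ 3 + a ≠ v ^ 3 + a := fun u v huv h => huv (hinj u v h)
    have hsq : ∀ u v : F, u ^ 2 ≠ v ^ 2 → u ≠ v := fun u v h h' => h (by rw [h'])
    refine false_of_pair_sums (c := 2 * a) (mul_ne_zero h2 ha) hxy hl1 ?_ ?_
      (hne x (-x) (hself x hx)) (hne y (-y) (hself y hy))
      (hne x y (hsq _ _ hxy)) (hne x (-y) (hsq _ _ (by simpa using hxy)))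
      (hne (-x) y (hsq _ _ (by simpa using hxy))) (hne (-x) (-y) (hsq _ _ (by simpa using hxy)))
      (hval x (by simp)) (hval (-x) (by simp)) (hval y (by simp)) (hval (-y) (by simp)) <;> ring
end
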